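/- arXiv:2209.00212 — 2 statements merged into one kernel-verified Lean document; each statement's English description precedes it below -/
import Mathlib

section
/- For every integer n ≥ 1 and every real x with z_n ≤ x ≤ 1, one has P_n(x) ≤ x. -/
open MeasureTheory Filter

/-- The `n`-th Legendre polynomial, via Rodrigues formula:
`P_n(x) = (1/(2^n n!)) (d/dx)^n (x^2 - 1)^n`. -/
noncomputable def legP (n : ℕ) : ℝ → ℝ := fun x =>
  (1 / ((2 : ℝ) ^ n * (n.factorial : ℝ))) *
    iteratedDeriv n (fun y : ℝ => (y ^ 2 - 1) ^ n) x

/-- Positive part of the `n`-th Legendre polynomial. -/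
noncomputable def legPpos (n : ℕ) (x : ℝ) : ℝ := max (legP n x) 0

/-- Negative part of the `n`-th Legendre polynomial. -/
noncomputable def legPneg (n : ℕ) (x : ℝ) : ℝ := max (-legP n x) 0

open Polynomial in
noncomputable def legQ (n : ℕ) : Polynomial ℝ :=
  C (1 / ((2 : ℝ) ^ n * (n.factorial : ℝ))) * derivative^[n] ((X ^ 2 - 1) ^ n)

open Polynomial in
theorem legP_eq (n : ℕ) (x : ℝ) : legP n x = (legQ n).eval x := by
  have h : (fun y : ℝ => (y ^ 2 - 1) ^ n) = fun y => ((X ^ 2 - 1 : ℝ[X]) ^ n).eval y := by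
    funext y; simp
  have key : ∀ (k : ℕ) (p : ℝ[X]), iteratedDeriv k (fun y => p.eval y)
      = fun y => (derivative^[k] p).eval y := by
    intro k
    induction k with
    | zero => intro p; simp
    | succ k ih =>
      intro p
      rw [iteratedDeriv_succ, ih, Function.iterate_succ_apply']
      funext y
      exact Polynomial.deriv _
  unfold legP legQ
  rw [h, key]
  simp

open Polynomial in
theorem legQ_one (n : ℕ) : (legQ n).eval 1 = 1 := by
  have h := Polynomial.aeval_iterate_derivative_self (A := ℝ) ((X ^ 2 - 1 : ℝ[X]) ^ n) n 1
    (p' := (X + 1) ^ n) (by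
      rw [← mul_pow]; simp; congr 1; ring)
  have h' : (derivative^[n] ((X ^ 2 - 1 : ℝ[X]) ^ n)).eval 1 = n.factorial * 2 ^ n := by
    simpa [one_add_one_eq_two] using h
  unfold legQ
  rw [eval_mul, h', eval_C]
  have : (n.factorial : ℝ) ≠ 0 := by exact_mod_cast n.factorial_ne_zero
  field_simp

open Polynomial in
theorem iter_X_mul (k : ℕ) (p : ℝ[X]) :
    derivative^[k+1] (X * p) = X * derivative^[k+1] p + (k+1 : ℝ[X]) * derivative^[k] p := by
  induction k with
  | zero => simp; ring
  | succ k ih =>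
    rw [Function.iterate_succ_apply', ih]
    have e : ((k : ℝ[X]) + 1) = ((k + 1 : ℕ) : ℝ[X]) := by push_cast; ring
    rw [e]
    simp only [derivative_add, derivative_mul, derivative_X, derivative_natCast,
      ← Function.iterate_succ_apply']
    push_cast
    ring

open Polynomial in
theorem legQ_ode (n : ℕ) (hn : 1 ≤ n) :
    (X ^ 2 - 1) * derivative (derivative (legQ n)) + 2 * X * derivative (legQ n)
      = (n * (n + 1) : ℝ[X]) * legQ n := by
  obtain ⟨m, rfl⟩ : ∃ m, n = m + 1 := ⟨n - 1, by omega⟩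
  set u : ℝ[X] := (X ^ 2 - 1) ^ (m + 1) with hu
  have h1 : X * (X * derivative u) - derivative u = C (2 * (m + 1 : ℝ)) * (X * u) := by
    have hC : (C (2:ℝ) : ℝ[X]) = 2 := rfl
    rw [hu, derivative_pow]
    simp [hC]
    ring
  have h2 := congrArg (fun p => derivative^[m + 1 + 1] p) h1
  simp only [iterate_derivative_sub, iterate_derivative_C_mul, iter_X_mul] at h2
  simp only [← Function.iterate_succ_apply] at h2
  unfold legQ
  rw [← hu]
  simp only [derivative_mul, derivative_C, zero_mul, zero_add, ← Function.iterate_succ_apply']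
  simp only [Nat.succ_eq_add_one] at *
  simp only [map_mul, map_add, map_ofNat, map_natCast, map_one] at h2
  push_cast at *
  linear_combination (C (1 / ((2 : ℝ) ^ (m+1) * ((m+1).factorial : ℝ)))) * h2

theorem legP_neg (n : ℕ) (x : ℝ) : legP n (-x) = (-1) ^ n * legP n x := by
  unfold legP
  have h := iteratedDeriv_comp_neg n (fun y : ℝ => (y ^ 2 - 1) ^ n) (-x)
  simp only [neg_sq, neg_neg, smul_eq_mul] at h
  rw [h]; ring

/-- For $n ≥ 1$ and $x ∈ [z_n, 1]$, where $z_n$ is the largest real zero of $P_n$,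
one has $P_n(x) ≤ x$. -/
theorem legP_le_id (n : ℕ) (hn : 1 ≤ n) (z : ℝ)
    (hz : IsGreatest {x : ℝ | legP n x = 0} z)
    (x : ℝ) (hx : x ∈ Set.Icc z 1) :
    legP n x ≤ x := by
  obtain ⟨hz0, hzm⟩ := hz
  have hz0' : legP n z = 0 := hz0
  have hzn : 0 ≤ z := by
    have : -z ≤ z := hzm (by simp [legP_neg, hz0'])
    linarith
  obtain ⟨hzx, hx1⟩ := hx
  rcases hzx.eq_or_lt with rfl | hzx
  · rw [hz0']; exact hzn
  have hx0 : 0 < x := lt_of_le_of_lt hzn hzx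
  simp only [legP_eq] at *
  have hP1 := legQ_one n
  have hode := fun y => congrArg (Polynomial.eval y) (legQ_ode n hn)
  simp only [Polynomial.eval_add, Polynomial.eval_mul, Polynomial.eval_sub, Polynomial.eval_pow,
    Polynomial.eval_X, Polynomial.eval_one, Polynomial.eval_ofNat, Polynomial.eval_natCast] at hode
  generalize legQ n = P at *
  have hpos : ∀ y, z < y → y ≤ 1 → 0 ≤ P.eval y := by
    intro y hy hy1
    by_contra! hneg
    obtain ⟨c, hc, hc0⟩ := intermediate_value_Icc hy1 P.continuous.continuousOn
      (show (0:ℝ) ∈ Set.Icc (P.eval y) (P.eval 1) from ⟨hneg.le, by rw [hP1]; norm_num⟩)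
    have := hzm (show c ∈ _ from hc0)
    linarith [hc.1]
  have hn' : (1:ℝ) ≤ n := by exact_mod_cast hn
  have hW : MonotoneOn (fun y => (1 - y^2) * (P.eval y - y * P.derivative.eval y))
      (Set.Icc x 1) := by
    have hd : ∀ y, HasDerivAt (fun y => (1 - y^2) * (P.eval y - y * P.derivative.eval y))
        ((n * (n+1) - 2) * y * P.eval y) y := by
      intro y
      have := (((hasDerivAt_id y).pow 2).const_sub 1).mul
        ((P.hasDerivAt y).sub ((hasDerivAt_id y).mul (P.derivative.hasDerivAt y)))
      refine HasDerivAt.congr_deriv (f := fun y => (1 - y^2) * (P.eval y - y * P.derivative.eval y)) this ?_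
      simp
      linear_combination (y) * hode y
    refine monotoneOn_of_deriv_nonneg (convex_Icc _ _) (fun y _ => (hd y).continuousAt.continuousWithinAt)
      (fun y _ => (hd y).differentiableAt.differentiableWithinAt) ?_
    intro y hy
    rw [interior_Icc] at hy
    rw [(hd y).deriv]
    have := hpos y (hzx.trans hy.1) hy.2.le
    have h2 : (0:ℝ) ≤ n * (n+1) - 2 := by nlinarith
    have h3 : 0 ≤ y := (hx0.trans hy.1).le
    positivity
  have hF : MonotoneOn (fun y => P.eval y / y) (Set.Icc x 1) := by
    have hd : ∀ y, y ≠ 0 → HasDerivAt (fun y => P.eval y / y)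
        ((P.derivative.eval y * y - P.eval y * 1) / y ^ 2) y :=
      fun y hy => (P.hasDerivAt y).div (hasDerivAt_id y) hy
    refine monotoneOn_of_deriv_nonneg (convex_Icc _ _)
      (fun y hy => (hd y (by linarith [hy.1])).continuousAt.continuousWithinAt) ?_ ?_
    · intro y hy
      rw [interior_Icc] at hy
      exact (hd y (hx0.trans hy.1).ne').differentiableAt.differentiableWithinAt
    intro y hy
    rw [interior_Icc] at hy
    have hy0 := hx0.trans hy.1
    rw [(hd y hy0.ne').deriv]
    have h := hW ⟨hy.1.le, hy.2.le⟩ ⟨hx1, le_rfl⟩ hy.2.le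
    simp only [one_pow, sub_self, zero_mul] at h
    have h1 : 0 < 1 - y ^ 2 := by nlinarith [hy.2]
    have h2 : P.eval y - y * P.derivative.eval y ≤ 0 := by
      by_contra! hc
      linarith [mul_pos h1 hc]
    apply div_nonneg _ (sq_nonneg _)
    linarith
  have h := hF ⟨le_rfl, hx1⟩ ⟨hx1, le_rfl⟩ hx1
  simp only [hP1, div_one] at h
  rwa [div_le_one hx0] at h
end

section
/- For every integer n ≥ 1 and every real p > 0, ∫₀¹ P_{4n,+}(x)^p dx ≥ 1/(2(p+1)·n·(4n+1)). -/
open MeasureTheory Filter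

open Polynomial in
lemma aux_iter (k : ℕ) : ∀ (q : ℤ[X]) (c : ℝ),
    iteratedDeriv k (fun y : ℝ => c * aeval ((1 - y) / 2) q) =
      fun y => c * (-1 / 2) ^ k * aeval ((1 - y) / 2) (derivative^[k] q) := by
  induction k with
  | zero => intro q c; simp
  | succ k ih =>
    intro q c
    rw [iteratedDeriv_succ']
    have h : deriv (fun y : ℝ => c * aeval ((1 - y) / 2) q) =
        fun y => (c * (-1 / 2)) * aeval ((1 - y) / 2) (derivative q) := by
      funext y
      have h1 : HasDerivAt (fun y : ℝ => (1 - y) / 2) (-1 / 2) y :=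
        ((hasDerivAt_id y).const_sub 1).div_const 2
      have h2 : HasDerivAt (fun y : ℝ => aeval ((1 - y) / 2) q)
          (aeval ((1 - y) / 2) (derivative q) * (-1 / 2)) y :=
        (HasDerivAt.comp (h₂ := fun z : ℝ => aeval z q) y
          (Polynomial.hasDerivAt_aeval q ((1 - y) / 2)) h1 :)
      rw [(h2.const_mul c).deriv]
      ring
    rw [h, ih]
    funext y
    rw [Function.iterate_succ_apply]
    ring

open Polynomial in
lemma legP_eq_s6 (n : ℕ) (x : ℝ) : legP n x = ∑ k ∈ Finset.range (n + 1),
    (-1 : ℝ) ^ k * ((n.choose k : ℝ) * ((n + k).choose n : ℝ) * ((1 - x) / 2) ^ k) := by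
  have h : (fun y : ℝ => (y ^ 2 - 1) ^ n) =
      fun y => (-4 : ℝ) ^ n * aeval ((1 - y) / 2) ((X : ℤ[X]) ^ n * (1 - X) ^ n) := by
    funext y
    simp only [map_mul, map_pow, map_sub, aeval_X, map_one]
    rw [← mul_pow, ← mul_pow]
    congr 1
    ring
  have hf : (n.factorial : ℝ) ≠ 0 := by positivity
  unfold legP
  rw [h, aux_iter, ← factorial_mul_shiftedLegendre_eq]
  simp only [map_mul, map_natCast]
  rw [← mul_pow, show (-4 : ℝ) * (-1 / 2) = 2 by norm_num]
  rw [show (1 / ((2 : ℝ) ^ n * n.factorial)) * (2 ^ n * (n.factorial *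
      aeval ((1 - x) / 2) (shiftedLegendre n))) = aeval ((1 - x) / 2) (shiftedLegendre n) by
    field_simp]
  unfold shiftedLegendre
  rw [map_sum]
  refine Finset.sum_congr rfl fun k _ => ?_
  simp
  ring

lemma aux_alt (a : ℕ → ℝ) (ha : ∀ k, a (k + 1) ≤ a k) (m : ℕ) :
    a 0 - a 1 ≤ ∑ k ∈ Finset.range (2 * (m + 1)), (-1 : ℝ) ^ k * a k := by
  induction m with
  | zero => simp [Finset.sum_range_succ, sub_eq_add_neg]
  | succ m ih =>
    rw [show 2 * (m + 1 + 1) = 2 * (m + 1) + 1 + 1 by ring, Finset.sum_range_succ,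
      Finset.sum_range_succ, pow_succ, pow_mul]
    have := ha (2 * (m + 1))
    norm_num
    linarith

lemma aux_anti (N : ℕ) (t : ℝ) (ht : 0 ≤ t) (ht' : (N : ℝ) * (N + 1) * t ≤ 1) (k : ℕ) :
    (N.choose (k + 1) : ℝ) * ((N + (k + 1)).choose N : ℝ) * t ^ (k + 1) ≤
      (N.choose k : ℝ) * ((N + k).choose N : ℝ) * t ^ k := by
  by_cases hk : N < k + 1
  · rw [Nat.choose_eq_zero_of_lt hk]
    simp only [Nat.cast_zero, zero_mul]
    positivity
  have h1 : (N.choose (k + 1) : ℝ) * (k + 1) = N.choose k * ((N : ℝ) - k) := by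
    have := Nat.choose_succ_right_eq N k
    rw [← Nat.cast_sub (by omega)]
    exact_mod_cast this
  have h2 : ((N + (k + 1)).choose N : ℝ) * (k + 1) = (N + k).choose N * ((N : ℝ) + k + 1) := by
    have := Nat.choose_mul_succ_eq (N + k) N
    rw [show N + k + 1 - N = k + 1 by omega] at this
    have h3 : (((N + k).choose N * (N + k + 1) : ℕ) : ℝ) = _ := congrArg Nat.cast this
    push_cast at h3
    rw [← add_assoc]
    linarith
  have hkN : (k : ℝ) + 1 ≤ N := by exact_mod_cast (not_lt.mp hk)
  have hk0 : (0 : ℝ) ≤ k := Nat.cast_nonneg k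
  set c := (N.choose k : ℝ) * ((N + k).choose N : ℝ) * t ^ k with hc
  have hc0 : 0 ≤ c := by positivity
  have h3 : (N.choose (k + 1) : ℝ) * ((N + (k + 1)).choose N : ℝ) * t ^ (k + 1) * ((k + 1) * (k + 1))
      = c * ((((N : ℝ) - k) * (N + k + 1)) * t) := by
    calc _ = ((N.choose (k + 1) : ℝ) * (k + 1)) * (((N + (k + 1)).choose N : ℝ) * (k + 1)) * t ^ (k + 1) := by ring
      _ = _ := by rw [h1, h2, hc]; ring
  have h4 : (((N : ℝ) - k) * (N + k + 1)) * t ≤ 1 := by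
    refine le_trans ?_ ht'
    apply mul_le_mul_of_nonneg_right _ ht
    nlinarith
  have h5 : c * ((((N : ℝ) - k) * (N + k + 1)) * t) ≤ c * 1 :=
    mul_le_mul_of_nonneg_left h4 hc0
  have h6 : 0 ≤ (N.choose (k + 1) : ℝ) * ((N + (k + 1)).choose N : ℝ) * t ^ (k + 1) := by positivity
  have h7 := le_mul_of_one_le_right h6 (show (1 : ℝ) ≤ ((k : ℝ) + 1) * (k + 1) by nlinarith)
  linarith

lemma legP_ge (n : ℕ) (x : ℝ) (hx : x ≤ 1)
    (hx' : 2 * (n : ℝ) * (4 * n + 1) * (1 - x) ≤ 1) :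
    1 - 2 * (n : ℝ) * (4 * n + 1) * (1 - x) ≤ legP (4 * n) x := by
  have ht : 0 ≤ (1 - x) / 2 := by linarith
  have h := aux_alt (fun k => ((4 * n).choose k : ℝ) * ((4 * n + k).choose (4 * n) : ℝ)
    * ((1 - x) / 2) ^ k) (aux_anti (4 * n) _ ht (by push_cast; linarith)) (2 * n)
  rw [show 2 * (2 * n + 1) = 4 * n + 1 + 1 by ring, Finset.sum_range_succ, ← legP_eq_s6] at h
  simp [Nat.choose_succ_self_right] at h
  linarith

/-- For $n ≥ 1$ and $p > 0$, $∫_0^1 P_{4n,+}(x)^p\,dx ≥ 1/(2(p+1)n(4n+1))$. -/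
theorem integral_legPpos_rpow_ge (n : ℕ) (hn : 1 ≤ n) (p : ℝ) (hp : 0 < p) :
    1 / (2 * (p + 1) * (n : ℝ) * (4 * (n : ℝ) + 1)) ≤
      ∫ x in (0:ℝ)..1, (legPpos (4 * n) x) ^ p := by
  have hn' : (1 : ℝ) ≤ n := by exact_mod_cast hn
  obtain ⟨A, hA⟩ : ∃ A : ℝ, A = 2 * (n : ℝ) * (4 * n + 1) := ⟨_, rfl⟩
  have hA1 : 1 ≤ A := by rw [hA]; nlinarith
  have hA0 : A ≠ 0 := by positivity
  have hcont : Continuous (fun x => (legPpos (4 * n) x) ^ p) := by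
    have h1 : Continuous (legP (4 * n)) := by
      rw [show legP (4 * n) = _ from funext (legP_eq_s6 (4 * n))]
      fun_prop
    exact (h1.max continuous_const).rpow_const fun _ => Or.inr hp.le
  have hcont2 : Continuous (fun x : ℝ => (A * x + (1 - A)) ^ p) :=
    Continuous.rpow_const (by fun_prop) fun _ => Or.inr hp.le
  have hinv : A⁻¹ ≤ 1 := inv_le_one_of_one_le₀ hA1
  have hinv0 : 0 < A⁻¹ := by positivity
  have hAi : A * A⁻¹ = 1 := mul_inv_cancel₀ hA0
  have hI : ∫ x in (1 - A⁻¹)..1, (A * x + (1 - A)) ^ p = 1 / (2 * (p + 1) * (n : ℝ) * (4 * (n : ℝ) + 1)) := by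
    rw [intervalIntegral.integral_comp_mul_add (fun x => x ^ p) hA0,
      show A * (1 - A⁻¹) + (1 - A) = 0 by rw [mul_sub, hAi]; ring,
      show A * 1 + (1 - A) = 1 by ring, integral_rpow (Or.inl (by linarith)),
      Real.one_rpow, Real.zero_rpow (by linarith)]
    rw [hA, smul_eq_mul]
    field_simp
    try ring
  have hnn : ∀ x, 0 ≤ (legPpos (4 * n) x) ^ p := fun x => Real.rpow_nonneg (le_max_right _ _) _
  rw [← hI, ← intervalIntegral.integral_add_adjacent_intervals
    (hcont.intervalIntegrable 0 (1 - A⁻¹)) (hcont.intervalIntegrable (1 - A⁻¹) 1)]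
  have h1 : 0 ≤ ∫ x in (0:ℝ)..(1 - A⁻¹), (legPpos (4 * n) x) ^ p :=
    intervalIntegral.integral_nonneg (by linarith) fun x _ => hnn x
  have h2 : ∫ x in (1 - A⁻¹)..1, (A * x + (1 - A)) ^ p ≤
      ∫ x in (1 - A⁻¹)..1, (legPpos (4 * n) x) ^ p := by
    refine intervalIntegral.integral_mono_on (by linarith) (hcont2.intervalIntegrable _ _)
      (hcont.intervalIntegrable _ _) fun x hx => ?_
    have h3 : A * (1 - x) ≤ 1 := by
      rw [← hAi]
      exact mul_le_mul_of_nonneg_left (by linarith [hx.1]) (by linarith)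
    have h4 := legP_ge n x hx.2 (by rw [← hA]; exact h3)
    rw [← hA] at h4
    refine Real.rpow_le_rpow (by linarith) ?_ hp.le
    exact le_trans (by linarith) (le_max_left _ _)
  linarith
end
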